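/- Let n be a natural number and let p ≥ 1 with p ≠ 2. Then the set of linear maps T : (Fin n → ℝ) → (Fin n → ℝ) satisfying ∑ᵢ |T(v) i|^p = ∑ᵢ |v i|^p for every v is finite (its cardinality is at most 2ⁿ · n!). -/

import Mathlib

/-- Strict superadditivity of `x ↦ x ^ q` for `q > 1`. -/
theorem rpow_add_rpow_lt_add_rpow {a b q : ℝ} (ha : 0 < a) (hb : 0 < b) (hq : 1 < q) :
    a ^ q + b ^ q < (a + b) ^ q := by
  have split : ∀ x : ℝ, 0 < x → x ^ q = x * x ^ (q - 1) := fun x hx => by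
    rw [← Real.rpow_one_add' hx.le (by linarith)]; congr 1; ring
  have h1 := Real.rpow_lt_rpow ha.le (lt_add_of_pos_right a hb) (sub_pos.2 hq)
  have h2 := Real.rpow_lt_rpow hb.le (lt_add_of_pos_left b ha) (sub_pos.2 hq)
  rw [split a ha, split b hb, split (a + b) (add_pos ha hb), add_mul]
  gcongr

/-- Strict subadditivity of `x ↦ x ^ q` for `0 < q < 1`. -/
theorem add_rpow_lt_rpow_add_rpow {a b q : ℝ} (ha : 0 < a) (hb : 0 < b) (hq0 : 0 < q)
    (hq : q < 1) : (a + b) ^ q < a ^ q + b ^ q := by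
  have split : ∀ x : ℝ, 0 < x → x ^ q = x * x ^ (q - 1) := fun x hx => by
    rw [← Real.rpow_one_add' hx.le (by linarith)]; congr 1; ring
  have h1 := Real.rpow_lt_rpow_of_neg ha (lt_add_of_pos_right a hb) (sub_neg.2 hq)
  have h2 := Real.rpow_lt_rpow_of_neg hb (lt_add_of_pos_left b ha) (sub_neg.2 hq)
  rw [split a ha, split b hb, split (a + b) (add_pos ha hb), add_mul]
  gcongr

theorem abs_rpow_eq_sq_rpow (x p : ℝ) : |x| ^ p = (x ^ 2) ^ (p / 2) := by
  rw [← sq_abs, ← Real.rpow_natCast, ← Real.rpow_mul (abs_nonneg x)]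
  congr 1
  push_cast
  ring

/-- Clarkson's inequality on the real line for `p > 2`, with strictness. -/
theorem clarkson_lt_of_two_lt {a b p : ℝ} (ha : a ≠ 0) (hb : b ≠ 0) (hp : 2 < p) :
    2 * (|a| ^ p + |b| ^ p) < |a + b| ^ p + |a - b| ^ p := by
  simp only [abs_rpow_eq_sq_rpow]
  have h1 := rpow_add_rpow_lt_add_rpow (q := p / 2) (pow_pos (abs_pos.2 ha) 2)
    (pow_pos (abs_pos.2 hb) 2) (by linarith)
  have h2 := (convexOn_rpow (p := p / 2) (by linarith)).2 (sq_nonneg (a + b)) (sq_nonneg (a - b))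
    (by norm_num : (0 : ℝ) ≤ 1 / 2) (by norm_num : (0 : ℝ) ≤ 1 / 2) (by norm_num)
  have e : (1 / 2 : ℝ) • (a + b) ^ 2 + (1 / 2 : ℝ) • (a - b) ^ 2 = a ^ 2 + b ^ 2 := by
    simp only [smul_eq_mul]; ring
  simp only [e] at h2
  simp only [sq_abs, smul_eq_mul] at h1 h2
  linarith

/-- The reverse Clarkson inequality on the real line for `0 < p < 2`, with strictness. -/
theorem clarkson_lt_of_lt_two {a b p : ℝ} (ha : a ≠ 0) (hb : b ≠ 0) (hp0 : 0 < p) (hp : p < 2) :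
    |a + b| ^ p + |a - b| ^ p < 2 * (|a| ^ p + |b| ^ p) := by
  simp only [abs_rpow_eq_sq_rpow]
  have h1 := add_rpow_lt_rpow_add_rpow (q := p / 2) (pow_pos (abs_pos.2 ha) 2)
    (pow_pos (abs_pos.2 hb) 2) (by linarith) (by linarith)
  have h2 := (Real.concaveOn_rpow (p := p / 2) (by linarith) (by linarith)).2
    (sq_nonneg (a + b)) (sq_nonneg (a - b))
    (by norm_num : (0 : ℝ) ≤ 1 / 2) (by norm_num : (0 : ℝ) ≤ 1 / 2) (by norm_num)
  have e : (1 / 2 : ℝ) • (a + b) ^ 2 + (1 / 2 : ℝ) • (a - b) ^ 2 = a ^ 2 + b ^ 2 := by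
    simp only [smul_eq_mul]; ring
  simp only [e] at h2
  simp only [sq_abs, smul_eq_mul] at h1 h2
  linarith

/-- Equality in the summed Clarkson inequality forces disjoint supports. -/
theorem mul_eq_zero_of_sum_clarkson_eq {ι : Type*} [Fintype ι] {p : ℝ} (hp0 : 0 < p)
    (hp2 : p ≠ 2) {a b : ι → ℝ}
    (h : ∑ i, (|a i + b i| ^ p + |a i - b i| ^ p) = ∑ i, 2 * (|a i| ^ p + |b i| ^ p)) (i : ι) :
    a i * b i = 0 := by
  have key : ∀ j, a j * b j = 0 →
      |a j + b j| ^ p + |a j - b j| ^ p = 2 * (|a j| ^ p + |b j| ^ p) := by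
    intro j hj
    rcases mul_eq_zero.1 hj with h0 | h0 <;> simp [h0, Real.zero_rpow hp0.ne'] <;> ring
  by_contra hi
  rcases lt_or_gt_of_ne hp2 with hp | hp
  · refine (Finset.sum_lt_sum (fun j _ => ?_) ⟨i, Finset.mem_univ i, ?_⟩).ne h
    · by_cases hj : a j * b j = 0
      · exact (key j hj).le
      · exact (clarkson_lt_of_lt_two (left_ne_zero_of_mul hj) (right_ne_zero_of_mul hj) hp0 hp).le
    · exact clarkson_lt_of_lt_two (left_ne_zero_of_mul hi) (right_ne_zero_of_mul hi) hp0 hp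
  · refine (Finset.sum_lt_sum (fun j _ => ?_) ⟨i, Finset.mem_univ i, ?_⟩).ne' h
    · by_cases hj : a j * b j = 0
      · exact (key j hj).ge
      · exact (clarkson_lt_of_two_lt (left_ne_zero_of_mul hj) (right_ne_zero_of_mul hj) hp).le
    · exact clarkson_lt_of_two_lt (left_ne_zero_of_mul hi) (right_ne_zero_of_mul hi) hp

/-- The signed coordinate permutation sending the `j`-th basis vector to `ε j` times the
`σ j`-th one. -/
noncomputable def signedPermMap {ι : Type*} [Fintype ι] [DecidableEq ι]
    (x : Equiv.Perm ι × (ι → ℤˣ)) : (ι → ℝ) →ₗ[ℝ] (ι → ℝ) :=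
  (Pi.basisFun ℝ ι).constr ℝ fun j => Pi.single (x.1 j) ((x.2 j : ℤ) : ℝ)

/-- The finite-dimensional Lamperti theorem: for `p ≠ 2`, a linear map preserving the
`p`-th-power weight sum is a signed coordinate permutation. -/
theorem mem_range_signedPermMap {ι : Type*} [Fintype ι] [DecidableEq ι] {p : ℝ} (hp0 : 0 < p)
    (hp2 : p ≠ 2) {T : (ι → ℝ) →ₗ[ℝ] (ι → ℝ)}
    (hT : ∀ v : ι → ℝ, ∑ i, |T v i| ^ p = ∑ i, |v i| ^ p) :
    T ∈ Set.range (signedPermMap (ι := ι)) := by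
  let e : ι → ι → ℝ := fun j => Pi.single j 1
  have hsingle : ∀ j (c : ℝ), ∑ i, |(Pi.single j c : ι → ℝ) i| ^ p = |c| ^ p := by
    intro j c
    rw [Finset.sum_eq_single j (fun i _ hij => by simp [hij, Real.zero_rpow hp0.ne']) (by simp)]
    simp
  have hone : ∀ j, ∑ i, |T (e j) i| ^ p = 1 := fun j => by
    rw [hT, hsingle, abs_one, Real.one_rpow]
  have hdisj : ∀ j k, j ≠ k → ∀ i, T (e j) i * T (e k) i = 0 := by
    intro j k hjk
    apply mul_eq_zero_of_sum_clarkson_eq hp0 hp2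
    have hadd := hT (e j + e k)
    have hsub := hT (e j - e k)
    have hcomb : ∑ i, (|e j i + e k i| ^ p + |e j i - e k i| ^ p)
        = ∑ i, 2 * (|e j i| ^ p + |e k i| ^ p) := by
      refine Finset.sum_congr rfl fun i _ => ?_
      by_cases hij : i = j
      · have hik : i ≠ k := fun h => hjk (hij.symm.trans h)
        simp only [e, Pi.single_eq_of_ne hik, add_zero, sub_zero, abs_zero,
          Real.zero_rpow hp0.ne']
        ring
      · simp only [e, Pi.single_eq_of_ne hij, zero_add, zero_sub, abs_neg, abs_zero,
          Real.zero_rpow hp0.ne']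
        ring
    simp only [map_add, map_sub, Pi.add_apply, Pi.sub_apply] at hadd hsub
    rw [Finset.sum_add_distrib, hadd, hsub, ← Finset.sum_add_distrib, hcomb,
      ← Finset.mul_sum, ← Finset.mul_sum, Finset.sum_add_distrib, Finset.sum_add_distrib,
      hT, hT]
  have hex : ∀ j, ∃ i, T (e j) i ≠ 0 := by
    intro j
    by_contra! h
    have := hone j
    simp [h, Real.zero_rpow hp0.ne'] at this
  choose σ hσ using hex
  have hinj : Function.Injective σ := by
    intro j k hjk
    by_contra hne
    exact mul_ne_zero (hσ j) (hjk ▸ hσ k) (hdisj j k hne (σ j))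
  have hbij := Finite.injective_iff_bijective.1 hinj
  have hcol : ∀ j, T (e j) = Pi.single (σ j) (T (e j) (σ j)) := by
    intro j
    ext i
    by_cases hi : i = σ j
    · subst hi; simp
    · obtain ⟨k, rfl⟩ := hbij.2 i
      rw [Pi.single_eq_of_ne hi]
      exact (mul_eq_zero.1 (hdisj j k (fun h => hi (h ▸ rfl)) (σ k))).resolve_right (hσ k)
  have hsign : ∀ j, ∃ u : ℤˣ, ((u : ℤ) : ℝ) = T (e j) (σ j) := by
    intro j
    have h1 := hone j
    rw [hcol j, hsingle, ← Real.one_rpow p,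
      Real.rpow_left_inj (abs_nonneg _) zero_le_one hp0.ne'] at h1
    rcases eq_or_eq_neg_of_abs_eq h1 with h | h
    · exact ⟨1, by simp [h]⟩
    · exact ⟨-1, by simp [h]⟩
  choose ε hε using hsign
  refine ⟨(Equiv.ofBijective σ hbij, ε), (Pi.basisFun ℝ ι).ext fun j => ?_⟩
  rw [signedPermMap, Module.Basis.constr_basis, Pi.basisFun_apply]
  simp only [Equiv.ofBijective_apply, hε]
  exact (hcol j).symm

/-- For `p ≥ 1`, `p ≠ 2`, the set of linear maps on `ℝⁿ` preserving the
`p`-th-power weight sum is finite, of cardinality at most `2 ^ n * n!`. -/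
theorem lamperti_isometries_finite (n : ℕ) (p : ℝ) (hp : 1 ≤ p) (hp2 : p ≠ 2) :
    {T : (Fin n → ℝ) →ₗ[ℝ] (Fin n → ℝ) |
        ∀ v : Fin n → ℝ, ∑ i, |T v i| ^ p = ∑ i, |v i| ^ p}.Finite ∧
      Nat.card {T : (Fin n → ℝ) →ₗ[ℝ] (Fin n → ℝ) |
          ∀ v : Fin n → ℝ, ∑ i, |T v i| ^ p = ∑ i, |v i| ^ p} ≤
        2 ^ n * n.factorial := by
  have hsub : {T : (Fin n → ℝ) →ₗ[ℝ] (Fin n → ℝ) |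
      ∀ v : Fin n → ℝ, ∑ i, |T v i| ^ p = ∑ i, |v i| ^ p} ⊆
        Set.range (signedPermMap (ι := Fin n)) :=
    fun _ hT => mem_range_signedPermMap (by linarith) hp2 hT
  have hfin := Set.finite_range (signedPermMap (ι := Fin n))
  refine ⟨hfin.subset hsub, (Nat.card_mono hfin hsub).trans ?_⟩
  refine (Finite.card_range_le _).trans_eq ?_
  simp [Nat.card_eq_fintype_card, Fintype.card_perm, mul_comm]
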